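/- Let k ≥ d ≥ 2 and let x ∈ (ℝ^d)^k be a nondegenerate configuration. Then there exist a unique t ∈ ℝ \ {0} and unique vectors z^{d+1},…,z^k ∈ ℝ^d such that the configuration (e^1,…,e^{d−1}, t e^d, z^{d+1},…,z^k) has the same volume type as x; moreover t = det(x^1,…,x^d). -/

import Mathlib

noncomputable section

/-- The determinant of the `d × d` matrix with columns `x 0, …, x (d-1)`. -/
def detCols {d : ℕ} (x : Fin d → (Fin d → ℝ)) : ℝ :=
  Matrix.det (Matrix.of fun l i => x i l)

/-- The volume type of a configuration `x ∈ (ℝ^d)^k`. -/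
def volType (d k : ℕ) (x : Fin k → (Fin d → ℝ)) :
    {S : Finset (Fin k) // S.card = d} → ℝ :=
  fun S => detCols fun j => x (S.1.orderIsoOfFin S.2 j)

/-- A configuration `x ∈ (ℝ^d)^k` is nondegenerate if its first `d` points are
linearly independent. -/
def Nondegenerate (d k : ℕ) (hk : d ≤ k) (x : Fin k → (Fin d → ℝ)) : Prop :=
  LinearIndependent ℝ fun i : Fin d => x (Fin.castLE hk i)

/-- The configuration `(e^1, …, e^{d-1}, t e^d, z^{d+1}, …, z^k)`, where
`e^1, …, e^d` are the standard basis vectors of `ℝ^d`. -/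
def baseConfig (d k : ℕ) (t : ℝ) (z : Fin (k - d) → (Fin d → ℝ)) :
    Fin k → (Fin d → ℝ) :=
  fun i =>
    if h1 : i.1 + 1 < d then fun l => if l.1 = i.1 then 1 else 0
    else if h2 : i.1 + 1 = d then fun l => if l.1 = i.1 then t else 0
    else z ⟨i.1 - d, by have := i.2; omega⟩

theorem detCols_mulVec {d : ℕ} (M : Matrix (Fin d) (Fin d) ℝ) (x : Fin d → (Fin d → ℝ)) :
    detCols (fun i => M.mulVec (x i)) = M.det * detCols x := by
  unfold detCols
  rw [← Matrix.det_mul]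
  rfl

theorem detCols_comp_perm {d : ℕ} (x : Fin d → (Fin d → ℝ)) (σ : Equiv.Perm (Fin d)) :
    detCols (fun i => x (σ i)) = (Equiv.Perm.sign σ : ℤ) * detCols x :=
  Matrix.det_permute' σ (Matrix.of fun l i => x i l)

/-- Equality of volume types extends to arbitrary, not necessarily increasing, index tuples. -/
theorem detCols_comp_eq_of_volType_eq {d k : ℕ} {x y : Fin k → (Fin d → ℝ)}
    (h : volType d k x = volType d k y) (f : Fin d → Fin k) :
    detCols (fun i => x (f i)) = detCols (fun i => y (f i)) := by
  by_cases hf : Function.Injective f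
  · have hS : (Finset.univ.image f).card = d := by
      simp [Finset.card_image_of_injective _ hf]
    let e := (Finset.univ.image f).orderIsoOfFin hS
    let σ₀ : Fin d → Fin d := fun i =>
      e.symm ⟨f i, Finset.mem_image_of_mem f (Finset.mem_univ i)⟩
    have hσ₀ : Function.Injective σ₀ := fun a b hab =>
      hf (congrArg Subtype.val (e.symm.injective hab))
    let σ : Equiv.Perm (Fin d) := Equiv.ofBijective σ₀ (Finite.injective_iff_bijective.mp hσ₀)
    have hfσ : ∀ i, f i = e (σ i) := fun i => by simp [σ, σ₀]
    simp only [hfσ]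
    rw [detCols_comp_perm (fun i => x (e i)) σ, detCols_comp_perm (fun i => y (e i)) σ]
    exact congrArg _ (congrFun h ⟨_, hS⟩)
  · simp only [Function.Injective, not_forall] at hf
    obtain ⟨a, b, hab, hne⟩ := hf
    have hzero : ∀ w : Fin k → (Fin d → ℝ), detCols (fun i => w (f i)) = 0 := fun w =>
      Matrix.det_zero_of_column_eq hne fun l => by simp [hab]
    rw [hzero, hzero]

/-- A configuration is determined by its volume type and its first `d` points, provided these
are linearly independent. -/
theorem eq_of_volType_eq {d k : ℕ} (hk : d ≤ k) {x y : Fin k → (Fin d → ℝ)}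
    (h : volType d k x = volType d k y)
    (hxy : ∀ i : Fin d, x (Fin.castLE hk i) = y (Fin.castLE hk i))
    (hx : detCols (fun i : Fin d => x (Fin.castLE hk i)) ≠ 0) : x = y := by
  funext j
  let A : Matrix (Fin d) (Fin d) ℝ := Matrix.of fun l i => x (Fin.castLE hk i) l
  have hcramer : A.cramer (x j) = A.cramer (y j) := by
    funext i
    rw [Matrix.cramer_apply, Matrix.cramer_apply]
    have key := detCols_comp_eq_of_volType_eq h (Function.update (Fin.castLE hk) i j)
    unfold detCols at key
    convert key using 2
    · ext l m
      by_cases hm : m = i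
      · subst hm; simp
      · simp [hm, A]
    · ext l m
      by_cases hm : m = i
      · subst hm; simp
      · simp [hm, A, hxy]
  have hsmul := congrArg A.mulVec hcramer
  rw [Matrix.mulVec_cramer, Matrix.mulVec_cramer] at hsmul
  exact smul_right_injective _ hx hsmul

theorem volType_mulVec {d k : ℕ} (M : Matrix (Fin d) (Fin d) ℝ) (hM : M.det = 1)
    (x : Fin k → (Fin d → ℝ)) : volType d k (fun i => M.mulVec (x i)) = volType d k x := by
  funext S
  simp only [volType, detCols_mulVec, hM, one_mul]

/-- The matrix whose columns are `e^1, …, e^{d-1}, t e^d`. -/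
def baseMatrix (d : ℕ) (t : ℝ) : Matrix (Fin d) (Fin d) ℝ :=
  Matrix.diagonal fun i => if i.1 + 1 = d then t else 1

theorem det_baseMatrix {d : ℕ} (hd : 0 < d) (t : ℝ) : (baseMatrix d t).det = t := by
  have hlast : ∀ i : Fin d, i.1 + 1 = d ↔ i = ⟨d - 1, by omega⟩ := fun i => by
    rw [Fin.ext_iff]
    simp only
    omega
  simp [baseMatrix, Matrix.det_diagonal, hlast]

theorem baseConfig_castLE {d k : ℕ} (hk : d ≤ k) (t : ℝ) (z : Fin (k - d) → (Fin d → ℝ))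
    (i : Fin d) : baseConfig d k t z (Fin.castLE hk i) = fun l => baseMatrix d t l i := by
  funext l
  have hi := i.2
  by_cases h : i.1 + 1 = d
  · by_cases hl : l = i
    · subst hl; simp [baseConfig, baseMatrix, h]
    · simp [baseConfig, baseMatrix, h, hl, Fin.val_inj]
  · have h1 : i.1 + 1 < d := by omega
    by_cases hl : l = i
    · subst hl; simp [baseConfig, baseMatrix, h, h1]
    · simp [baseConfig, baseMatrix, h1, hl, Fin.val_inj]

theorem baseConfig_of_le {d k : ℕ} (t : ℝ) (z : Fin (k - d) → (Fin d → ℝ))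
    (i : Fin k) (hi : d ≤ i.1) :
    baseConfig d k t z i = z ⟨i.1 - d, by have := i.2; omega⟩ := by
  have h1 : ¬ i.1 + 1 < d := by omega
  have h2 : ¬ i.1 + 1 = d := by omega
  simp [baseConfig, h1, h2]

theorem detCols_baseConfig {d k : ℕ} (hd : 0 < d) (hk : d ≤ k) (t : ℝ)
    (z : Fin (k - d) → (Fin d → ℝ)) :
    detCols (fun i : Fin d => baseConfig d k t z (Fin.castLE hk i)) = t := by
  simp only [baseConfig_castLE]
  exact det_baseMatrix hd t

theorem baseConfig_injective {d k : ℕ} (t : ℝ) :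
    Function.Injective (baseConfig d k t) := by
  intro z w h
  funext j
  have hj := congrFun h ⟨d + j.1, by omega⟩
  rw [baseConfig_of_le _ _ _ (by simp), baseConfig_of_le _ _ _ (by simp)] at hj
  simpa using hj

theorem Nondegenerate.detCols_ne_zero {d k : ℕ} {hk : d ≤ k} {x : Fin k → (Fin d → ℝ)}
    (hx : Nondegenerate d k hk x) : detCols (fun i : Fin d => x (Fin.castLE hk i)) ≠ 0 := by
  have hunit : IsUnit (Matrix.of fun l i : Fin d => x (Fin.castLE hk i) l) :=
    Matrix.linearIndependent_cols_iff_isUnit.mp hx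
  exact ((Matrix.isUnit_iff_isUnit_det _).mp hunit).ne_zero

theorem Nondegenerate.exists_volType_baseConfig_eq {d k : ℕ} (hd : 0 < d) {hk : d ≤ k}
    {x : Fin k → (Fin d → ℝ)} (hx : Nondegenerate d k hk x) :
    ∃ z, volType d k (baseConfig d k (detCols fun i : Fin d => x (Fin.castLE hk i)) z) =
      volType d k x := by
  let A : Matrix (Fin d) (Fin d) ℝ := Matrix.of fun l i => x (Fin.castLE hk i) l
  have hA : A.det ≠ 0 := hx.detCols_ne_zero
  let M := baseMatrix d A.det * A⁻¹
  have hM : M.det = 1 := by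
    rw [Matrix.det_mul, det_baseMatrix hd, Matrix.det_nonsing_inv, Ring.inverse_eq_inv',
      mul_inv_cancel₀ hA]
  have hMA : M * A = baseMatrix d A.det := by
    rw [Matrix.mul_assoc, Matrix.nonsing_inv_mul _ hA.isUnit, Matrix.mul_one]
  refine ⟨fun j => M.mulVec (x ⟨d + j.1, by omega⟩), ?_⟩
  rw [← volType_mulVec M hM x]
  congr 1
  funext i
  rcases lt_or_ge i.1 d with hi | hi
  · have hcast : i = Fin.castLE hk ⟨i.1, hi⟩ := rfl
    rw [hcast, baseConfig_castLE]
    change (fun l => baseMatrix d A.det l _) = _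
    rw [← hMA]
    rfl
  · rw [baseConfig_of_le _ _ _ hi]
    congr 2
    ext
    simp only
    omega

/-- Every nondegenerate configuration has a unique canonical representative of
its volume type of the form `(e^1, …, e^{d-1}, t e^d, z^{d+1}, …, z^k)` with
`t ≠ 0`; moreover `t = det(x^1, …, x^d)`. -/
theorem canonical_representative (d k : ℕ) (hd : 2 ≤ d) (hk : d ≤ k)
    (x : Fin k → (Fin d → ℝ)) (hx : Nondegenerate d k hk x) :
    (∃! p : ℝ × (Fin (k - d) → (Fin d → ℝ)),
        p.1 ≠ 0 ∧ volType d k (baseConfig d k p.1 p.2) = volType d k x) ∧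
      ∀ p : ℝ × (Fin (k - d) → (Fin d → ℝ)),
        p.1 ≠ 0 ∧ volType d k (baseConfig d k p.1 p.2) = volType d k x →
          p.1 = detCols fun i : Fin d => x (Fin.castLE hk i) := by
  have ht : ∀ p : ℝ × (Fin (k - d) → (Fin d → ℝ)),
      p.1 ≠ 0 ∧ volType d k (baseConfig d k p.1 p.2) = volType d k x →
        p.1 = detCols fun i : Fin d => x (Fin.castLE hk i) := by
    rintro ⟨t, z⟩ ⟨-, h⟩
    rw [← detCols_comp_eq_of_volType_eq h, detCols_baseConfig (by omega)]
  refine ⟨?_, ht⟩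
  obtain ⟨z, hz⟩ := hx.exists_volType_baseConfig_eq (by omega)
  refine ⟨(_, z), ⟨hx.detCols_ne_zero, hz⟩, ?_⟩
  rintro ⟨t, w⟩ hw
  obtain rfl : t = _ := ht _ hw
  refine Prod.ext rfl (baseConfig_injective _ (eq_of_volType_eq hk (hw.2.trans hz.symm) ?_ ?_))
  · intro i
    rw [baseConfig_castLE, baseConfig_castLE]
  · rw [detCols_baseConfig (by omega)]
    exact hw.1
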